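/- (Cell-average projection error.) Let w ∈ L¹(ℝ^d) and K ≥ 0 satisfy ∫_{ℝ^d} |w(x+h) − w(x)| dx ≤ K|h| for all h ∈ ℝ^d, and define the piecewise constant cell-average projection w̄ by w̄(x) = Δx^{−d} ∫_{R_α} w(y) dy for x ∈ R_α, α ∈ ℤ^d. Then ∫_{ℝ^d} |w̄(x) − w(x)| dx ≤ 2^d √d · K · Δx. -/

import Mathlib

open MeasureTheory Set

noncomputable section

abbrev Ed (d : ℕ) := EuclideanSpace ℝ (Fin d)

def cell (d : ℕ) (dx : ℝ) (α : Fin d → ℤ) : Set (Ed d) :=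
  {x | ∀ i, dx * (α i : ℝ) < x i ∧ x i < dx * (α i : ℝ) + dx}

def ind (d : ℕ) (S : Set (Ed d)) : Ed d → ℝ :=
  S.indicator fun _ => 1

def gam (d : ℕ) (dx : ℝ) (μ : Measure (Ed d)) (l : Fin d) : ℝ :=
  - ∫ z in {z : Ed d | dx / 2 < ‖z‖ ∧ ‖z‖ ≤ 1}, z l ∂μ

def Dup (d : ℕ) (dx : ℝ) (μ : Measure (Ed d)) (l : Fin d) (φ : Ed d → ℝ) (x : Ed d) : ℝ :=
  if 0 < gam d dx μ l then (φ (x + EuclideanSpace.single l dx) - φ x) / dx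
  else (φ x - φ (x - EuclideanSpace.single l dx)) / dx

def Glow (d : ℕ) (dx : ℝ) (μ : Measure (Ed d)) (α β : Fin d → ℤ) : ℝ :=
  (dx ^ d)⁻¹ *
    ∫ x in cell d dx α, ∫ z in {z : Ed d | dx / 2 < ‖z‖},
      (ind d (cell d dx β) (x + z) - ind d (cell d dx β) x) ∂μ

def Gup (d : ℕ) (dx : ℝ) (μ : Measure (Ed d)) (α β : Fin d → ℤ) : ℝ :=
  (dx ^ d)⁻¹ *
    ∑ l : Fin d, gam d dx μ l * ∫ x in cell d dx α, Dup d dx μ l (ind d (cell d dx β)) x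

def Gw (d : ℕ) (dx : ℝ) (μ : Measure (Ed d)) (α β : Fin d → ℤ) : ℝ :=
  Glow d dx μ α β + Gup d dx μ α β

def GsplitLow (d : ℕ) (dx r : ℝ) (μ : Measure (Ed d)) (α β : Fin d → ℤ) : ℝ :=
  (dx ^ d)⁻¹ *
    ∫ x in cell d dx α, ∫ z in {z : Ed d | dx / 2 < ‖z‖ ∧ ‖z‖ ≤ r},
      (ind d (cell d dx β) (x + z) - ind d (cell d dx β) x) ∂μ

def GsplitHigh (d : ℕ) (dx r : ℝ) (μ : Measure (Ed d)) (α β : Fin d → ℤ) : ℝ :=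
  (dx ^ d)⁻¹ *
      ∫ x in cell d dx α, ∫ z in {z : Ed d | r < ‖z‖},
        (ind d (cell d dx β) (x + z) - ind d (cell d dx β) x) ∂μ
    + Gup d dx μ α β

def Aok (A : ℝ → ℝ) (LA : ℝ) : Prop :=
  Monotone A ∧ (∀ a b : ℝ, |A a - A b| ≤ LA * |a - b|) ∧ A 0 = 0

def SolvesImplicitStep (d : ℕ) (dx : ℝ) (μ : Measure (Ed d)) (A : ℝ → ℝ) (dt : ℝ)
    (u h : (Fin d → ℤ) → ℝ) : Prop :=
  ∀ α, Summable (fun β => Gw d dx μ α β * A (u β)) ∧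
    u α - dt * ∑' β, Gw d dx μ α β * A (u β) = h α

def Fractional (d : ℕ) (μ : Measure (Ed d)) (lam clam : ℝ) : Prop :=
  ∀ B : Set (Ed d), MeasurableSet B → B ⊆ {z : Ed d | 0 < ‖z‖ ∧ ‖z‖ < 1} →
    μ B ≤ ∫⁻ z in B, ENNReal.ofReal (clam * ‖z‖ ^ (-(d : ℝ) - lam))

def Lhat (d : ℕ) (dx : ℝ) (μ : Measure (Ed d)) (w : Ed d → ℝ) (x : Ed d) : ℝ :=
  (∫ z in {z : Ed d | dx / 2 < ‖z‖}, (w (x + z) - w x) ∂μ) +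
    ∑ l : Fin d, gam d dx μ l * Dup d dx μ l w x

def Ubar (d : ℕ) (dx : ℝ) (U : (Fin d → ℤ) → ℝ) (x : Ed d) : ℝ :=
  ∑' α : Fin d → ℤ, U α * ind d (cell d dx α) x

def cellAvg (d : ℕ) (dx : ℝ) (w : Ed d → ℝ) (x : Ed d) : ℝ :=
  ∑' α : Fin d → ℤ, Set.indicator (cell d dx α)
    (fun _ => (dx ^ d)⁻¹ * ∫ y in cell d dx α, w y) x


theorem mem_cell_unique {d : ℕ} {dx : ℝ} (hdx : 0 < dx) {α β : Fin d → ℤ} {x : Ed d}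
    (hα : x ∈ cell d dx α) (hβ : x ∈ cell d dx β) : α = β := by
  funext i
  have h1 : (α i : ℝ) < β i + 1 := by
    have := (hα i).1.trans (hβ i).2
    exact lt_of_mul_lt_mul_left (by linarith) hdx.le
  have h2 : (β i : ℝ) < α i + 1 := by
    have := (hβ i).1.trans (hα i).2
    exact lt_of_mul_lt_mul_left (by linarith) hdx.le
  have h1' : α i < β i + 1 := by exact_mod_cast h1
  have h2' : β i < α i + 1 := by exact_mod_cast h2
  omega

theorem cellAvg_eq_of_mem {d : ℕ} {dx : ℝ} (hdx : 0 < dx) (w : Ed d → ℝ) {α : Fin d → ℤ}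
    {x : Ed d} (hx : x ∈ cell d dx α) :
    cellAvg d dx w x = (dx ^ d)⁻¹ * ∫ y in cell d dx α, w y := by
  unfold cellAvg
  rw [tsum_eq_single α, indicator_of_mem hx]
  intro β hβ
  exact indicator_of_notMem (fun h => hβ (mem_cell_unique hdx h hx)) _

theorem ae_exists_mem_cell (d : ℕ) {dx : ℝ} (hdx : 0 < dx) :
    ∀ᵐ x : Ed d, ∃ α, x ∈ cell d dx α := by
  have h : ∀ᵐ x : Fin d → ℝ, ∀ (i : Fin d) (n : ℤ), x i ≠ dx * n := by
    rw [ae_all_iff]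
    intro i
    rw [ae_all_iff]
    intro n
    exact Measure.ae_eval_ne (fun _ : Fin d => (volume : Measure ℝ)) i (dx * n)
  filter_upwards [(PiLp.volume_preserving_ofLp
    (Fin d)).quasiMeasurePreserving.ae h] with x hx
  refine ⟨fun i => ⌊x i / dx⌋, fun i => ⟨?_, ?_⟩⟩
  · refine lt_of_le_of_ne ?_ (hx i _).symm
    have := Int.floor_le (x i / dx)
    rwa [le_div_iff₀ hdx, mul_comm] at this
  · have := Int.lt_floor_add_one (x i / dx)
    rw [div_lt_iff₀ hdx] at this
    linarith

theorem volume_setOf_forall_mem_Ioo {d : ℕ} (a b : Fin d → ℝ) :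
    volume {x : Ed d | ∀ i, a i < x i ∧ x i < b i} = ∏ i, ENNReal.ofReal (b i - a i) := by
  rw [← Real.volume_pi_Ioo, ← (PiLp.volume_preserving_ofLp (Fin d)).measure_preimage
    (MeasurableSet.univ_pi fun _ => measurableSet_Ioo).nullMeasurableSet]
  congr 1
  ext x
  simp

theorem measurableSet_setOf_forall_mem_Ioo {d : ℕ} (a b : Fin d → ℝ) :
    MeasurableSet {x : Ed d | ∀ i, a i < x i ∧ x i < b i} := by
  have : {x : Ed d | ∀ i, a i < x i ∧ x i < b i} =
      WithLp.ofLp ⁻¹' (univ.pi fun i => Ioo (a i) (b i)) := by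
    ext x
    simp
  rw [this]
  exact (PiLp.volume_preserving_ofLp (Fin d)).measurable
    (MeasurableSet.univ_pi fun _ => measurableSet_Ioo)

theorem measurableSet_cell (d : ℕ) (dx : ℝ) (α : Fin d → ℤ) : MeasurableSet (cell d dx α) :=
  measurableSet_setOf_forall_mem_Ioo _ _

theorem volume_cell (d : ℕ) (dx : ℝ) (α : Fin d → ℤ) :
    volume (cell d dx α) = ENNReal.ofReal dx ^ d := by
  unfold cell
  rw [volume_setOf_forall_mem_Ioo]
  simp

/-- The open cube of side length `2 * dx` centred at the origin. -/
def centredCube (d : ℕ) (dx : ℝ) : Set (Ed d) :=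
  {x | ∀ i, -dx < x i ∧ x i < dx}

theorem measurableSet_centredCube (d : ℕ) (dx : ℝ) : MeasurableSet (centredCube d dx) :=
  measurableSet_setOf_forall_mem_Ioo _ _

theorem volume_centredCube (d : ℕ) (dx : ℝ) :
    volume (centredCube d dx) = ENNReal.ofReal (2 * dx) ^ d := by
  unfold centredCube
  rw [volume_setOf_forall_mem_Ioo]
  simp [two_mul]

theorem norm_le_of_mem_centredCube {d : ℕ} {dx : ℝ} (hdx : 0 < dx) {x : Ed d}
    (hx : x ∈ centredCube d dx) : ‖x‖ ≤ Real.sqrt d * dx := by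
  rw [EuclideanSpace.norm_eq]
  refine Real.sqrt_le_iff.2 ⟨by positivity, ?_⟩
  rw [mul_pow, Real.sq_sqrt (Nat.cast_nonneg d)]
  calc ∑ i, ‖x i‖ ^ 2 ≤ ∑ _i : Fin d, dx ^ 2 := by
        refine Finset.sum_le_sum fun i _ => ?_
        have : ‖x i‖ ≤ dx := abs_le.2 ⟨(hx i).1.le, (hx i).2.le⟩
        gcongr
    _ = d * dx ^ 2 := by simp

theorem enorm_cellAvg_sub_le {d : ℕ} {dx : ℝ} (hdx : 0 < dx) {w : Ed d → ℝ}
    (hw : Integrable w volume) {α : Fin d → ℤ} {x : Ed d} (hx : x ∈ cell d dx α) :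
    ‖cellAvg d dx w x - w x‖ₑ ≤
      ENNReal.ofReal (dx ^ d)⁻¹ * ∫⁻ h in centredCube d dx, ‖w (x + h) - w x‖ₑ := by
  have hvol : volume (cell d dx α) ≠ ⊤ := by
    rw [volume_cell]
    exact ENNReal.pow_ne_top ENNReal.ofReal_ne_top
  have havg : cellAvg d dx w x - w x = (dx ^ d)⁻¹ * ∫ y in cell d dx α, (w y - w x) := by
    rw [cellAvg_eq_of_mem hdx w hx, integral_sub hw.integrableOn (integrableOn_const hvol),
      setIntegral_const, Measure.real, volume_cell, ENNReal.toReal_pow,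
      ENNReal.toReal_ofReal hdx.le, smul_eq_mul]
    field_simp
  rw [havg, enorm_mul, Real.enorm_of_nonneg (by positivity)]
  gcongr
  refine (enorm_integral_le_lintegral_enorm _).trans ?_
  rw [← lintegral_indicator (measurableSet_cell d dx α),
    ← lintegral_indicator (measurableSet_centredCube d dx),
    ← lintegral_add_left_eq_self _ x]
  refine lintegral_mono fun h => ?_
  by_cases hh : x + h ∈ cell d dx α
  · have hQ : h ∈ centredCube d dx := fun i => by
      have h1 := hh i
      have h2 := hx i
      simp only [PiLp.add_apply] at h1
      constructor <;> linarith
    simp [hh, hQ]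
  · simp [hh]

theorem aemeasurable_enorm_add_sub {d : ℕ} {w : Ed d → ℝ} (hw : AEStronglyMeasurable w volume)
    (Q : Set (Ed d)) :
    AEMeasurable (Function.uncurry fun x h : Ed d => ‖w (x + h) - w x‖ₑ)
      ((volume : Measure (Ed d)).prod (volume.restrict Q)) := by
  have hadd : AEStronglyMeasurable (fun p : Ed d × Ed d => w (p.1 + p.2))
      ((volume : Measure (Ed d)).prod volume) :=
    hw.comp_quasiMeasurePreserving
      (Measure.quasiMeasurePreserving_snd.comp
        (measurePreserving_prod_add (volume : Measure (Ed d)) volume).quasiMeasurePreserving)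
  exact ((hadd.sub hw.comp_fst).mono_ac
    (Measure.AbsolutelyContinuous.rfl.prod Measure.restrict_le_self.absolutelyContinuous)).enorm

theorem lintegral_enorm_translate_sub_le {d : ℕ} {w : Ed d → ℝ} (hw : Integrable w volume)
    {K : ℝ} (hmod : ∀ h : Ed d, (∫ x, |w (x + h) - w x|) ≤ K * ‖h‖) (h : Ed d) :
    ∫⁻ x, ‖w (x + h) - w x‖ₑ ≤ ENNReal.ofReal (K * ‖h‖) := by
  have hint : Integrable (fun x => w (x + h) - w x) volume := (hw.comp_add_right h).sub hw
  rw [← ofReal_integral_norm_eq_lintegral_enorm hint]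
  exact ENNReal.ofReal_le_ofReal (hmod h)

theorem stmt19 (d : ℕ) (hd : 1 ≤ d) (dx : ℝ) (hdx0 : 0 < dx) (hdx1 : dx < 1)
    (w : Ed d → ℝ) (hw : Integrable w volume)
    (K : ℝ) (hK : 0 ≤ K) (hmod : ∀ h : Ed d, (∫ x, |w (x + h) - w x|) ≤ K * ‖h‖) :
    (∫ x, |cellAvg d dx w x - w x|) ≤ 2 ^ d * Real.sqrt d * K * dx := by
  have hbound : ∫⁻ x, ‖cellAvg d dx w x - w x‖ₑ ≤
      ENNReal.ofReal (2 ^ d * Real.sqrt d * K * dx) := by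
    calc ∫⁻ x, ‖cellAvg d dx w x - w x‖ₑ
        ≤ ∫⁻ x, ENNReal.ofReal (dx ^ d)⁻¹ *
            ∫⁻ h in centredCube d dx, ‖w (x + h) - w x‖ₑ := by
          refine lintegral_mono_ae ?_
          filter_upwards [ae_exists_mem_cell d hdx0] with x ⟨α, hx⟩
          exact enorm_cellAvg_sub_le hdx0 hw hx
      _ = ENNReal.ofReal (dx ^ d)⁻¹ *
            ∫⁻ h in centredCube d dx, ∫⁻ x, ‖w (x + h) - w x‖ₑ := by
          rw [lintegral_const_mul' _ _ ENNReal.ofReal_ne_top,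
            lintegral_lintegral_swap (aemeasurable_enorm_add_sub hw.1 _)]
      _ ≤ ENNReal.ofReal (dx ^ d)⁻¹ *
            ∫⁻ _h in centredCube d dx, ENNReal.ofReal (K * (Real.sqrt d * dx)) := by
          refine mul_le_mul_right ?_ _
          refine setLIntegral_mono' (measurableSet_centredCube d dx) fun h hh => ?_
          refine (lintegral_enorm_translate_sub_le hw hmod h).trans
            (ENNReal.ofReal_le_ofReal ?_)
          gcongr
          exact norm_le_of_mem_centredCube hdx0 hh
      _ = ENNReal.ofReal (2 ^ d * Real.sqrt d * K * dx) := by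
          rw [setLIntegral_const, volume_centredCube, ← ENNReal.ofReal_pow (by positivity),
            ← ENNReal.ofReal_mul (by positivity), ← ENNReal.ofReal_mul (by positivity)]
          congr 1
          rw [mul_pow]
          field_simp
  refine (ENNReal.ofReal_le_ofReal_iff (by positivity)).1 (le_trans ?_ hbound)
  rw [← Real.enorm_of_nonneg (integral_nonneg fun _ => abs_nonneg _)]
  refine (enorm_integral_le_lintegral_enorm _).trans_eq ?_
  simp
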